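/- Let ε ∈ ℝ satisfy 1 + ε·h ≠ 0 and 1 + h ≠ 0, let ζ ∈ ℝ, let p, c ∈ ℝⁿ be column vectors, and set Δp = ζ·e_q. Then (p + ε·Δp)ᵀ·(H + ε·ΔH)⁻¹·c − pᵀ·H⁻¹·c = (ε·(1+h)/(1+ε·h)) · ( (p + Δp)ᵀ·(H + ΔH)⁻¹·c − pᵀ·H⁻¹·c ). (This is the key identity behind the paper's Lemma 1 for the average power: the average power of a convex combination of two scheduling policies differing in one state is a convex combination of the two average powers, with the same coefficient ε' = ε(1+h)/(1+εh) as for the average delay.) -/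

import Mathlib

open Matrix

/-- The Sherman–Morrison formula. -/
theorem Matrix.inv_add_vecMulVec {m K : Type*} [Fintype m] [DecidableEq m] [Field K]
    {A : Matrix m m K} (hA : IsUnit A.det) (u v : m → K) (h : 1 + v ⬝ᵥ (A⁻¹ *ᵥ u) ≠ 0) :
    (A + vecMulVec u v)⁻¹ =
      A⁻¹ - (1 + v ⬝ᵥ (A⁻¹ *ᵥ u))⁻¹ • vecMulVec (A⁻¹ *ᵥ u) (v ᵥ* A⁻¹) := by
  apply inv_eq_right_inv
  have hu : A *ᵥ (A⁻¹ *ᵥ u) = u := by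
    rw [mulVec_mulVec, mul_nonsing_inv A hA, one_mulVec]
  rw [mul_sub, add_mul, mul_nonsing_inv A hA, vecMulVec_mul, mul_smul_comm, add_mul,
    mul_vecMulVec, hu, vecMulVec_mul_vecMulVec]
  ext i j
  simp only [sub_apply, add_apply, smul_apply, vecMulVec_apply, Pi.smul_apply, smul_eq_mul]
  field_simp
  ring

/-- The Sherman–Morrison formula applied to a vector. -/
theorem Matrix.inv_add_vecMulVec_mulVec {m K : Type*} [Fintype m] [DecidableEq m] [Field K]
    {A : Matrix m m K} (hA : IsUnit A.det) (u v c : m → K) (h : 1 + v ⬝ᵥ (A⁻¹ *ᵥ u) ≠ 0) :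
    (A + vecMulVec u v)⁻¹ *ᵥ c =
      A⁻¹ *ᵥ c - ((v ⬝ᵥ (A⁻¹ *ᵥ c)) / (1 + v ⬝ᵥ (A⁻¹ *ᵥ u))) • (A⁻¹ *ᵥ u) := by
  rw [inv_add_vecMulVec hA u v h, sub_mulVec, smul_mulVec, vecMulVec_mulVec,
    ← dotProduct_mulVec, op_smul_eq_smul, smul_smul, div_eq_inv_mul]

theorem power_convex_combination_identity
    (n : ℕ) (hn : 1 ≤ n) (H : Matrix (Fin n) (Fin n) ℝ) (hH : IsUnit H.det)
    (δ : Fin n → ℝ) (q : Fin n) (ε : ℝ)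
    (hε : 1 + ε * (H⁻¹ *ᵥ δ) q ≠ 0) (h1 : 1 + (H⁻¹ *ᵥ δ) q ≠ 0)
    (ζ : ℝ) (p c : Fin n → ℝ) :
    (p + ε • (ζ • (Pi.single q 1 : Fin n → ℝ))) ⬝ᵥ
        ((H + ε • Matrix.vecMulVec δ (Pi.single q 1))⁻¹ *ᵥ c) - p ⬝ᵥ (H⁻¹ *ᵥ c) =
      ε * (1 + (H⁻¹ *ᵥ δ) q) / (1 + ε * (H⁻¹ *ᵥ δ) q) *
        ((p + ζ • (Pi.single q 1 : Fin n → ℝ)) ⬝ᵥ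
          ((H + Matrix.vecMulVec δ (Pi.single q 1))⁻¹ *ᵥ c) - p ⬝ᵥ (H⁻¹ *ᵥ c)) := by
  rw [← smul_vecMulVec, inv_add_vecMulVec_mulVec hH, inv_add_vecMulVec_mulVec hH]
  · simp only [mulVec_smul, single_one_dotProduct, add_dotProduct, smul_dotProduct,
      dotProduct_sub, dotProduct_smul, smul_eq_mul]
    field_simp
    ring
  · simpa using h1
  · simpa [mulVec_smul] using hε
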